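/- Let α ∈ (1, 3/2). For every f ∈ N^{3/2,2}(0,T; L²(Ω)) ∩ W^{1,2}(0,T;L²(Ω)), there is a constant C(α) such that ∫₀^T ‖ḟ(t)‖²_{L²(Ω)} dt ≤ C ∫₀^T ‖f‖²_{L²} dt + C(α) ( sup_{h∈(0,T)} h^{-1} ∫₀^{T-h} ‖ḟ(t+h) - ḟ(t)‖²_{L²} dt )^{1/α} ( ∫₀^T ‖f‖²_{L²} dt )^{1 - 1/α}. -/

import Mathlib

open MeasureTheory

/-- Cauchy–Schwarz against the constant function `1`. -/
lemma sq_intervalIntegral_le_mul_intervalIntegral_sq {φ : ℝ → ℝ} {a b : ℝ} (hab : a < b)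
    (hφ : IntervalIntegrable φ volume a b) (hφ2 : IntervalIntegrable (fun s => φ s ^ 2) volume a b) :
    (∫ s in a..b, φ s) ^ 2 ≤ (b - a) * ∫ s in a..b, φ s ^ 2 := by
  set I := ∫ s in a..b, φ s with hI
  set J := ∫ s in a..b, φ s ^ 2 with hJ
  have hexp : ∫ s in a..b, ((b - a) * φ s - I) ^ 2 =
      (b - a) ^ 2 * J - 2 * (b - a) * I * I + (b - a) * I ^ 2 := by
    have : ∀ s, ((b - a) * φ s - I) ^ 2 =
        (b - a) ^ 2 * φ s ^ 2 - 2 * (b - a) * I * φ s + I ^ 2 := fun s => by ring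
    simp only [this]
    rw [intervalIntegral.integral_add ((hφ2.const_mul _).sub (hφ.const_mul _)) (by simp),
      intervalIntegral.integral_sub (hφ2.const_mul _) (hφ.const_mul _),
      intervalIntegral.integral_const_mul, intervalIntegral.integral_const_mul,
      intervalIntegral.integral_const, smul_eq_mul]
  have hnn : 0 ≤ ∫ s in a..b, ((b - a) * φ s - I) ^ 2 :=
    intervalIntegral.integral_nonneg hab.le fun s _ => sq_nonneg _
  rw [hexp] at hnn
  have hpos : 0 < b - a := sub_pos.2 hab
  have : 0 ≤ (b - a) * ((b - a) * J - I ^ 2) := by nlinarith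
  linarith [nonneg_of_mul_nonneg_right this hpos]

section SquareIntegrable

variable {E : Type*} [NormedAddCommGroup E] {g : ℝ → E}

lemma intervalIntegrable_of_sq_norm {a b : ℝ} (hab : a ≤ b) (hg : StronglyMeasurable g)
    (hg2 : IntervalIntegrable (fun t => ‖g t‖ ^ 2) volume a b) :
    IntervalIntegrable g volume a b := by
  rw [intervalIntegrable_iff_integrableOn_Ioc_of_le hab] at hg2 ⊢
  exact ((memLp_two_iff_integrable_sq_norm hg.aestronglyMeasurable).2 hg2).integrable one_le_two

lemma IntervalIntegrable.sub_interval {F : Type*} [NormedAddCommGroup F] {φ : ℝ → F} {a b c d : ℝ}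
    (hφ : IntervalIntegrable φ volume a b) (hac : a ≤ c) (hcd : c ≤ d) (hdb : d ≤ b) :
    IntervalIntegrable φ volume c d := by
  refine hφ.mono_set ?_
  rw [Set.uIcc_of_le hcd, Set.uIcc_of_le (hac.trans (hcd.trans hdb))]
  exact Set.Icc_subset_Icc hac hdb

lemma intervalIntegrable_sq_norm_sub {u v : ℝ → E} {a b : ℝ}
    (hu : StronglyMeasurable u) (hv : StronglyMeasurable v)
    (hu2 : IntervalIntegrable (fun t => ‖u t‖ ^ 2) volume a b)
    (hv2 : IntervalIntegrable (fun t => ‖v t‖ ^ 2) volume a b) :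
    IntervalIntegrable (fun t => ‖u t - v t‖ ^ 2) volume a b := by
  refine ((hu2.const_mul 2).add (hv2.const_mul 2)).mono_fun
    ((hu.sub hv).norm.pow 2).aestronglyMeasurable (ae_of_all _ fun t => ?_)
  beta_reduce
  rw [Real.norm_of_nonneg (by positivity), Real.norm_of_nonneg (by positivity)]
  nlinarith [norm_sub_le (u t) (v t), norm_nonneg (u t - v t), sq_nonneg (‖u t‖ - ‖v t‖)]

lemma intervalIntegrable_sq_norm_translate {a b c d s : ℝ}
    (hg2 : IntervalIntegrable (fun t => ‖g t‖ ^ 2) volume a b)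
    (hac : a ≤ c + s) (hcd : c ≤ d) (hdb : d + s ≤ b) :
    IntervalIntegrable (fun t => ‖g (t + s)‖ ^ 2) volume c d := by
  simpa using (hg2.sub_interval hac (by linarith) hdb).comp_add_right s

end SquareIntegrable

/-- If the increments of the derivative `g` of `f` satisfy an `N^{1/2,2}` bound, the `L²` norm of
`g` away from the right end point is controlled by that of `f` and a small multiple of the bound. -/
lemma sq_mul_integral_deriv_le {E : Type*} [NormedAddCommGroup E] [NormedSpace ℝ E]
    [CompleteSpace E] {f g : ℝ → E} {T h M : ℝ} (hh : 0 < h) (hhT : h < T) (hM0 : 0 ≤ M)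
    (hg : StronglyMeasurable g) (hf : ∀ t ∈ Set.Icc 0 T, HasDerivAt f (g t) t)
    (hg2 : IntervalIntegrable (fun t => ‖g t‖ ^ 2) volume 0 T)
    (hM : ∀ s ∈ Set.Ioo 0 T, ∫ t in (0 : ℝ)..(T - s), ‖g (t + s) - g t‖ ^ 2 ≤ s * M) :
    h ^ 2 * ∫ t in (0 : ℝ)..(T - h), ‖g t‖ ^ 2 ≤
      6 * (∫ t in (0 : ℝ)..T, ‖f t‖ ^ 2) + 3 * h ^ 3 * M := by
  have hTh : 0 ≤ T - h := by linarith
  have hf2 : IntervalIntegrable (fun t => ‖f t‖ ^ 2) volume 0 T := by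
    refine ContinuousOn.intervalIntegrable ?_
    rw [Set.uIcc_of_le (by linarith)]
    exact ContinuousOn.pow (ContinuousOn.norm fun t ht => (hf t ht).continuousAt.continuousWithinAt) 2
  have hgs : ∀ s, StronglyMeasurable fun t => g (t + s) := fun s =>
    hg.comp_measurable (measurable_id.add_const s)
  have hgt : ∀ t, StronglyMeasurable fun s => g (t + s) := fun t =>
    hg.comp_measurable (measurable_id.const_add t)
  have hQs : ∀ s ∈ Set.Ioc 0 h,
      IntervalIntegrable (fun t => ‖g (t + s) - g t‖ ^ 2) volume 0 (T - s) := fun s hs =>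
    intervalIntegrable_sq_norm_sub (hgs s) hg
      (intervalIntegrable_sq_norm_translate hg2 (by linarith [hs.1]) (by linarith [hs.2])
        (by linarith))
      (hg2.sub_interval le_rfl (by linarith [hs.2]) (by linarith [hs.1]))
  have hQle : ∀ s ∈ Set.Ioc 0 h, ∫ t in (0 : ℝ)..(T - h), ‖g (t + s) - g t‖ ^ 2 ≤ h * M := by
    intro s hs
    calc ∫ t in (0 : ℝ)..(T - h), ‖g (t + s) - g t‖ ^ 2
        ≤ ∫ t in (0 : ℝ)..(T - s), ‖g (t + s) - g t‖ ^ 2 :=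
          intervalIntegral.integral_mono_interval le_rfl hTh (by linarith [hs.2])
            (ae_of_all _ fun t => sq_nonneg _) (hQs s hs)
      _ ≤ s * M := hM s ⟨hs.1, by linarith [hs.2]⟩
      _ ≤ h * M := by gcongr; exact hs.2
  set Q : ℝ × ℝ → ℝ := fun p => ‖g (p.1 + p.2) - g p.1‖ ^ 2 with hQ
  have hQm : StronglyMeasurable Q :=
    ((hg.comp_measurable (measurable_fst.add measurable_snd)).sub
      (hg.comp_measurable measurable_fst)).norm.pow 2
  set μ := (volume : Measure ℝ).restrict (Set.Ioc 0 (T - h))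
  set ν := (volume : Measure ℝ).restrict (Set.Ioc 0 h)
  have hQsle : ∀ᵐ s ∂ν, ∫ t, Q (t, s) ∂μ ≤ h * M := by
    filter_upwards [ae_restrict_mem measurableSet_Ioc] with s hs
    rw [← intervalIntegral.integral_of_le hTh]
    exact hQle s hs
  have hQsm : Integrable (fun s => ∫ t, Q (t, s) ∂μ) ν := by
    refine Integrable.mono' (integrable_const (h * M))
      hQm.integral_prod_left'.aestronglyMeasurable ?_
    filter_upwards [hQsle] with s hs
    rwa [Real.norm_of_nonneg (integral_nonneg fun t => sq_nonneg _)]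
  have hQi : Integrable Q (μ.prod ν) := by
    refine (integrable_prod_iff' hQm.aestronglyMeasurable).2 ⟨?_, ?_⟩
    · filter_upwards [ae_restrict_mem measurableSet_Ioc] with s hs
      exact (intervalIntegrable_iff_integrableOn_Ioc_of_le hTh).1
        ((hQs s hs).sub_interval le_rfl hTh (by linarith [hs.2]))
    · refine hQsm.congr (ae_of_all _ fun s => integral_congr_ae (ae_of_all _ fun t => ?_))
      exact (Real.norm_of_nonneg (sq_nonneg _)).symm
  have hQint : IntervalIntegrable (fun t => ∫ s, Q (t, s) ∂ν) volume 0 (T - h) :=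
    (intervalIntegrable_iff_integrableOn_Ioc_of_le hTh).2 hQi.integral_prod_left
  have hdouble : ∫ t in (0 : ℝ)..(T - h), ∫ s, Q (t, s) ∂ν ≤ h * (h * M) := by
    rw [intervalIntegral.integral_of_le hTh, integral_integral_swap (f := fun t s => Q (t, s)) hQi]
    refine (integral_mono_ae hQsm (integrable_const (h * M)) hQsle).trans_eq ?_
    simp [ν, hh.le]
  have hfh2 : IntervalIntegrable (fun t => ‖f (t + h)‖ ^ 2) volume 0 (T - h) :=
    intervalIntegrable_sq_norm_translate hf2 (by linarith) hTh (by linarith)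
  have hf02 : IntervalIntegrable (fun t => ‖f t‖ ^ 2) volume 0 (T - h) :=
    hf2.sub_interval le_rfl hTh (by linarith)
  have hpt : ∀ t ∈ Set.Icc 0 (T - h), h ^ 2 * ‖g t‖ ^ 2 ≤
      3 * ‖f (t + h)‖ ^ 2 + 3 * ‖f t‖ ^ 2 + 3 * h * ∫ s, Q (t, s) ∂ν := by
    intro t ht
    have hgt2 : IntervalIntegrable (fun s => ‖g (t + s)‖ ^ 2) volume 0 h := by
      simpa only [add_comm t] using intervalIntegrable_sq_norm_translate (s := t) hg2
        (by linarith [ht.1]) hh.le (by linarith [ht.2])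
    have hd2 : IntervalIntegrable (fun s => ‖g (t + s) - g t‖ ^ 2) volume 0 h :=
      intervalIntegrable_sq_norm_sub (hgt t) stronglyMeasurable_const hgt2 (by simp)
    have hd : IntervalIntegrable (fun s => g (t + s) - g t) volume 0 h :=
      intervalIntegrable_of_sq_norm hh.le ((hgt t).sub stronglyMeasurable_const) hd2
    have hgti : IntervalIntegrable (fun s => g (t + s)) volume 0 h :=
      intervalIntegrable_of_sq_norm hh.le (hgt t) hgt2
    have hftc : ∫ s in (0 : ℝ)..h, g (t + s) = f (t + h) - f t := by
      have := intervalIntegral.integral_eq_sub_of_hasDerivAt (a := 0) (b := h)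
        (f := fun s => f (t + s)) (f' := fun s => g (t + s)) (fun s hs => ?_) hgti
      · simpa using this
      · rw [Set.uIcc_of_le hh.le] at hs
        exact (hf (t + s) ⟨by linarith [ht.1, hs.1], by linarith [ht.2, hs.2]⟩).comp_const_add t s
    have heq : h • g t = f (t + h) - f t - ∫ s in (0 : ℝ)..h, (g (t + s) - g t) := by
      rw [intervalIntegral.integral_sub hgti (by simp), hftc]
      simp
    have hnorm : h * ‖g t‖ ≤ ‖f (t + h)‖ + ‖f t‖ + ∫ s in (0 : ℝ)..h, ‖g (t + s) - g t‖ := by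
      calc h * ‖g t‖ = ‖h • g t‖ := by rw [norm_smul, Real.norm_of_nonneg hh.le]
        _ ≤ ‖f (t + h)‖ + ‖f t‖ + ‖∫ s in (0 : ℝ)..h, (g (t + s) - g t)‖ := by
          rw [heq]
          exact (norm_sub_le _ _).trans (by gcongr; exact norm_sub_le _ _)
        _ ≤ _ := by
          gcongr
          exact intervalIntegral.norm_integral_le_integral_norm hh.le
    have hcs := sq_intervalIntegral_le_mul_intervalIntegral_sq hh hd.norm hd2
    have hQeq : ∫ s, Q (t, s) ∂ν = ∫ s in (0 : ℝ)..h, ‖g (t + s) - g t‖ ^ 2 :=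
      (intervalIntegral.integral_of_le hh.le).symm
    rw [hQeq]
    set I := ∫ s in (0 : ℝ)..h, ‖g (t + s) - g t‖
    have hsq : (h * ‖g t‖) ^ 2 ≤ (‖f (t + h)‖ + ‖f t‖ + I) ^ 2 := by gcongr
    nlinarith [sq_nonneg (‖f (t + h)‖ - ‖f t‖), sq_nonneg (‖f (t + h)‖ - I), sq_nonneg (‖f t‖ - I)]
  have hmono := intervalIntegral.integral_mono_on hTh
    ((hg2.sub_interval le_rfl hTh (by linarith)).const_mul (h ^ 2))
    (((hfh2.const_mul 3).add (hf02.const_mul 3)).add (hQint.const_mul (3 * h))) hpt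
  rw [intervalIntegral.integral_add ((hfh2.const_mul 3).add (hf02.const_mul 3))
      (hQint.const_mul (3 * h)),
    intervalIntegral.integral_add (hfh2.const_mul 3) (hf02.const_mul 3),
    intervalIntegral.integral_const_mul, intervalIntegral.integral_const_mul,
    intervalIntegral.integral_const_mul, intervalIntegral.integral_const_mul,
    intervalIntegral.integral_comp_add_right (fun t => ‖f t‖ ^ 2)] at hmono
  have h1 : ∫ t in (0 + h)..(T - h + h), ‖f t‖ ^ 2 ≤ ∫ t in (0 : ℝ)..T, ‖f t‖ ^ 2 :=
    intervalIntegral.integral_mono_interval (by linarith) (by linarith) (by linarith)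
      (ae_of_all _ fun t => sq_nonneg _) hf2
  have h2 : ∫ t in (0 : ℝ)..(T - h), ‖f t‖ ^ 2 ≤ ∫ t in (0 : ℝ)..T, ‖f t‖ ^ 2 :=
    intervalIntegral.integral_mono_interval le_rfl hTh (by linarith)
      (ae_of_all _ fun t => sq_nonneg _) hf2
  have h3 := mul_le_mul_of_nonneg_left hdouble (by positivity : 0 ≤ 3 * h)
  calc _ ≤ _ := hmono
    _ ≤ 3 * (∫ t in (0 : ℝ)..T, ‖f t‖ ^ 2) + 3 * (∫ t in (0 : ℝ)..T, ‖f t‖ ^ 2) +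
        3 * h * (h * (h * M)) := by gcongr
    _ = _ := by ring

/-- The previous estimate on both halves of the interval, the right half being obtained by
time reversal. -/
lemma sq_mul_integral_deriv_le_of_le_half {E : Type*} [NormedAddCommGroup E] [NormedSpace ℝ E]
    [CompleteSpace E] {f g : ℝ → E} {T h M : ℝ} (hh : 0 < h) (hhT : h ≤ T / 2) (hM0 : 0 ≤ M)
    (hg : StronglyMeasurable g) (hf : ∀ t ∈ Set.Icc 0 T, HasDerivAt f (g t) t)
    (hg2 : IntervalIntegrable (fun t => ‖g t‖ ^ 2) volume 0 T)
    (hM : ∀ s ∈ Set.Ioo 0 T, ∫ t in (0 : ℝ)..(T - s), ‖g (t + s) - g t‖ ^ 2 ≤ s * M) :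
    h ^ 2 * ∫ t in (0 : ℝ)..T, ‖g t‖ ^ 2 ≤
      12 * (∫ t in (0 : ℝ)..T, ‖f t‖ ^ 2) + 6 * h ^ 3 * M := by
  have hleft := sq_mul_integral_deriv_le hh (by linarith) hM0 hg hf hg2 hM
  have hright := sq_mul_integral_deriv_le (f := fun t => f (T - t)) (g := fun t => -g (T - t))
    (T := T) (M := M)
    hh (by linarith) hM0 (hg.comp_measurable (measurable_id.const_sub T)).neg
    (fun t ht => (hf (T - t) ⟨by linarith [ht.2], by linarith [ht.1]⟩).comp_const_sub T t)
    (by simpa using (hg2.comp_sub_left T).symm)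
    (fun s hs => by
      refine le_trans (le_of_eq ?_) (hM s hs)
      have := intervalIntegral.integral_comp_sub_left (a := 0) (b := T - s)
        (fun t => ‖g (t + s) - g t‖ ^ 2) (T - s)
      simp only [sub_self, sub_zero] at this
      rw [← this]
      refine intervalIntegral.integral_congr fun t _ => ?_
      have e1 : T - (t + s) = T - s - t := by ring
      have e2 : T - s - t + s = T - t := by ring
      simp only [e1, e2]
      congr 2
      abel)
  have e1 := intervalIntegral.integral_comp_sub_left (a := 0) (b := T - h)
    (fun t => ‖g t‖ ^ 2) T
  have e2 := intervalIntegral.integral_comp_sub_left (a := 0) (b := T) (fun t => ‖f t‖ ^ 2) T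
  simp only [sub_self, sub_zero, sub_sub_cancel] at e1 e2
  simp only [norm_neg, e1, e2] at hright
  have hsplit := intervalIntegral.integral_add_adjacent_intervals
    (hg2.sub_interval le_rfl hh.le (by linarith)) (hg2.sub_interval hh.le (by linarith) le_rfl)
  have hmono : ∫ t in (0 : ℝ)..h, ‖g t‖ ^ 2 ≤ ∫ t in (0 : ℝ)..(T - h), ‖g t‖ ^ 2 :=
    intervalIntegral.integral_mono_interval le_rfl hh.le (by linarith)
      (ae_of_all _ fun t => sq_nonneg _) (hg2.sub_interval le_rfl (by linarith) (by linarith))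
  have := mul_le_mul_of_nonneg_left hmono (sq_nonneg h)
  rw [← hsplit]
  linarith

/-- Optimising a two-term bound over scales `h ≤ L`. The exponents are not the optimal ones
(`θ = 1 / 3`), but any smaller `θ` follows as `A ≤ L ^ 3 * M` in the relevant range. -/
lemma le_of_forall_scale {A D M L θ : ℝ} (hL : 0 < L) (hA : 0 ≤ A) (hM : 0 ≤ M)
    (hθ : 0 < θ) (hθ3 : θ ≤ 1 / 3)
    (hD : ∀ h, 0 < h → h ≤ L → h ^ 2 * D ≤ 12 * A + 6 * h ^ 3 * M) :
    D ≤ 18 / L ^ 2 * A + 18 * L * (L ^ 3) ^ (-θ) * M ^ (1 - θ) * A ^ θ := by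
  have hL3 : 0 < L ^ 3 := by positivity
  rcases le_total (L ^ 3 * M) A with h | h
  · have h1 := hD L hL le_rfl
    have h2 : D ≤ 18 / L ^ 2 * A := by
      rw [div_mul_eq_mul_div, le_div_iff₀ (by positivity)]
      linarith
    have : 0 ≤ 18 * L * (L ^ 3) ^ (-θ) * M ^ (1 - θ) * A ^ θ := by positivity
    linarith
  rcases hA.eq_or_lt with rfl | hA'
  · have hD0 : D ≤ 0 := by
      refine le_of_forall_pos_le_add fun ε hε => ?_
      set h := min L (ε / (6 * M + 1))
      have hh : 0 < h := lt_min hL (by positivity)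
      have h1 := hD h hh (min_le_left _ _)
      have h2 : h * (6 * M + 1) ≤ ε := (le_div_iff₀ (by positivity)).1 (min_le_right _ _)
      have h3 : h ^ 2 * D ≤ h ^ 2 * (6 * h * M) := by linarith
      have h4 := le_of_mul_le_mul_left h3 (by positivity)
      linarith
    simpa [Real.zero_rpow hθ.ne'] using hD0
  · have hM' : 0 < M := by
      rcases hM.eq_or_lt with rfl | hM'
      · linarith
      · exact hM'
    set y := A / (L ^ 3 * M) with hy
    have hy0 : 0 < y := by positivity
    have hy1 : y ≤ 1 := (div_le_one (by positivity)).2 h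
    have hAy : A = y * (L ^ 3 * M) := by rw [hy]; field_simp
    have hyθ : 0 < y ^ θ := Real.rpow_pos_of_pos hy0 θ
    have hyθ1 : y ^ θ ≤ 1 := Real.rpow_le_one hy0.le hy1 hθ.le
    have hy3 : y ≤ (y ^ θ) ^ 3 := by
      rw [← Real.rpow_natCast, ← Real.rpow_mul hy0.le]
      calc y = y ^ (1 : ℝ) := (Real.rpow_one y).symm
        _ ≤ _ := Real.rpow_le_rpow_of_exponent_ge hy0 hy1 (by push_cast; linarith)
    have h1 := hD (L * y ^ θ) (by positivity) (by nlinarith)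
    have hprod : 18 * L * (L ^ 3) ^ (-θ) * M ^ (1 - θ) * A ^ θ = 18 * L * M * y ^ θ := by
      rw [hAy, Real.mul_rpow hy0.le (by positivity), Real.mul_rpow hL3.le hM,
        Real.rpow_neg hL3.le, Real.rpow_sub hM', Real.rpow_one]
      have := Real.rpow_pos_of_pos hL3 θ
      have := Real.rpow_pos_of_pos hM' θ
      field_simp
    have h2 : D ≤ 18 * L * M * y ^ θ := by
      refine le_of_mul_le_mul_left ?_ (by positivity : 0 < (L * y ^ θ) ^ 2)
      calc _ ≤ _ := h1
        _ ≤ 12 * ((y ^ θ) ^ 3 * (L ^ 3 * M)) + 6 * (L * y ^ θ) ^ 3 * M := by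
          rw [hAy]; gcongr
        _ = _ := by ring
    rw [hprod]
    have : 0 ≤ 18 / L ^ 2 * A := by positivity
    linarith

theorem stmt9 (H : Type*) [NormedAddCommGroup H] [InnerProductSpace ℝ H]
    (T : ℝ) (hT : 0 < T) (α : ℝ) (hα : α ∈ Set.Ioo 1 (3/2 : ℝ)) :
    ∃ C > 0, ∃ Cα > 0, ∀ (f f' : ℝ → H) (M : ℝ),
      (∀ t ∈ Set.Icc 0 T, HasDerivAt f (f' t) t) →
      IntegrableOn (fun t => ‖f t‖^2) (Set.Ioc 0 T) →
      IntegrableOn (fun t => ‖f' t‖^2) (Set.Ioc 0 T) →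
      0 ≤ M →
      (∀ h ∈ Set.Ioo (0:ℝ) T,
        h⁻¹ * ∫ t in (0:ℝ)..(T-h), ‖f' (t+h) - f' t‖^2 ≤ M) →
      ∫ t in (0:ℝ)..T, ‖f' t‖^2 ≤ C * (∫ t in (0:ℝ)..T, ‖f t‖^2) +
        Cα * M ^ (1/α) * (∫ t in (0:ℝ)..T, ‖f t‖^2) ^ (1 - 1/α) := by
  obtain ⟨hα1, hα2⟩ := hα
  have hL : 0 < T / 2 := by positivity
  refine ⟨18 / (T / 2) ^ 2, by positivity,
    18 * (T / 2) * ((T / 2) ^ 3) ^ (-(1 - 1 / α)), by positivity, ?_⟩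
  intro f f' M hf _ hf'2 hM0 hM
  have hα' : 1 - 1 / α ≤ 1 / 3 := by
    have : 2 / 3 ≤ 1 / α := by rw [le_div_iff₀ (by linarith)]; linarith
    linarith
  have hα0 : 0 < 1 - 1 / α := by
    have : 1 / α < 1 := by rw [div_lt_one (by linarith)]; exact hα1
    linarith
  let ι := UniformSpace.Completion.toComplL (𝕜 := ℝ) (E := H)
  have hι : ∀ x, ‖ι x‖ = ‖x‖ := UniformSpace.Completion.norm_coe
  set F : ℝ → UniformSpace.Completion H := fun t => ι (f t)
  have hFd : ∀ t ∈ Set.Icc 0 T, HasDerivAt F (ι (f' t)) t := fun t ht =>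
    ι.hasFDerivAt.comp_hasDerivAt t (hf t ht)
  have hder : ∀ t ∈ Set.Icc 0 T, deriv F t = ι (f' t) := fun t ht => (hFd t ht).deriv
  have hnorm : ∀ t ∈ Set.Icc 0 T, ‖deriv F t‖ ^ 2 = ‖f' t‖ ^ 2 := fun t ht => by
    rw [hder t ht, hι]
  have hD : ∫ t in (0 : ℝ)..T, ‖deriv F t‖ ^ 2 = ∫ t in (0 : ℝ)..T, ‖f' t‖ ^ 2 :=
    intervalIntegral.integral_congr fun t ht => hnorm t (by rwa [Set.uIcc_of_le hT.le] at ht)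
  have hA : ∫ t in (0 : ℝ)..T, ‖F t‖ ^ 2 = ∫ t in (0 : ℝ)..T, ‖f t‖ ^ 2 := by
    simp only [F, hι]
  have hg2 : IntervalIntegrable (fun t => ‖deriv F t‖ ^ 2) volume 0 T := by
    rw [intervalIntegrable_iff_integrableOn_Ioc_of_le hT.le]
    exact hf'2.congr_fun (fun t ht => (hnorm t ⟨ht.1.le, ht.2⟩).symm) measurableSet_Ioc
  have hMg : ∀ s ∈ Set.Ioo 0 T,
      ∫ t in (0 : ℝ)..(T - s), ‖deriv F (t + s) - deriv F t‖ ^ 2 ≤ s * M := by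
    intro s hs
    rw [← inv_mul_le_iff₀ hs.1]
    refine le_trans (le_of_eq ?_) (hM s hs)
    congr 1
    refine intervalIntegral.integral_congr fun t ht => ?_
    rw [Set.uIcc_of_le (by linarith [hs.2])] at ht
    have hs0 := hs.1
    simp only [hder t ⟨ht.1, by linarith [ht.2]⟩,
      hder (t + s) ⟨by linarith [ht.1], by linarith [ht.2]⟩, ← map_sub, hι]
  have key := le_of_forall_scale (A := ∫ t in (0 : ℝ)..T, ‖f t‖ ^ 2)
    (D := ∫ t in (0 : ℝ)..T, ‖f' t‖ ^ 2) hL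
    (intervalIntegral.integral_nonneg hT.le fun t _ => sq_nonneg _) hM0 hα0 hα' fun h hh hhT => by
      rw [← hD, ← hA]
      exact sq_mul_integral_deriv_le_of_le_half hh hhT hM0 (stronglyMeasurable_deriv F)
        (fun t ht => by rw [hder t ht]; exact hFd t ht) hg2 hMg
  rwa [sub_sub_cancel] at key
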